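/- arXiv:2006.04383 — 6 statements merged into one kernel-verified Lean document; each statement's English description precedes it below -/
import Mathlib

section
/- Let α = [[α_qq, α_qp],[α_pq, α_pp]] be a real symmetric 2s×2s matrix with s×s blocks (α_pq = α_qpᵀ) and α_qq positive definite, and let β be a real symmetric positive definite s×s matrix. Define the hatted blocks 𝛼̂_qq = (α_qq⁻¹+β⁻¹)⁻¹, 𝛼̂_qp = 𝛼̂_pqᵀ = (α_qq⁻¹+β⁻¹)⁻¹ α_qq⁻¹ α_qp, 𝛼̂_pp = α_pp − α_pq(α_qq+β)⁻¹α_qp + (1/4)β⁻¹. Then for all ξ, ξ' ∈ ℝ^s the complex quadratic forms satisfy (1/2)ξᵀβ⁻¹ξ + (1/2)ξ'ᵀβ⁻¹ξ' + θ_α(ξ,ξ') = θ_𝛼̂(ξ,ξ'), where 𝛼̂ is the 2s×2s matrix with blocks 𝛼̂_qq, 𝛼̂_qp, 𝛼̂_pq, 𝛼̂_pp. -/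
open Matrix

/-- The complex quadratic form `θ_α(ξ,ξ')` associated with a real symmetric
`2s×2s` covariance matrix `α` with blocks `α_qq = Aqq`, `α_qp = Aqp`,
`α_pq = Aqpᵀ`, `α_pp = App` (with `α_qq` positive definite):
`θ_α(ξ,ξ') = (1/4)(ξ'+ξ)ᵀα_qq⁻¹(ξ'+ξ) + (ξ'−ξ)ᵀ(α_pp − α_pq α_qq⁻¹ α_qp)(ξ'−ξ)
  + i(ξ'+ξ)ᵀα_qq⁻¹α_qp(ξ'−ξ)`. -/
noncomputable def theta {s : ℕ} (Aqq Aqp App : Matrix (Fin s) (Fin s) ℝ)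
    (ξ ξ' : Fin s → ℝ) : ℂ :=
  ((1/4 * ((ξ' + ξ) ⬝ᵥ (Aqq⁻¹ *ᵥ (ξ' + ξ))) : ℝ) : ℂ)
    + (((ξ' - ξ) ⬝ᵥ ((App - Aqpᵀ * Aqq⁻¹ * Aqp) *ᵥ (ξ' - ξ)) : ℝ) : ℂ)
    + Complex.I * (((ξ' + ξ) ⬝ᵥ ((Aqq⁻¹ * Aqp) *ᵥ (ξ' - ξ)) : ℝ) : ℂ)

/-- For `S = (A⁻¹ + B⁻¹)⁻¹`, the inverse of `A + B` is `A⁻¹ - A⁻¹ S A⁻¹`. -/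
theorem inv_add_add_inv_mul_mul_inv {n : Type*} [Fintype n] [DecidableEq n]
    {R : Type*} [CommRing R] {A B : Matrix n n R}
    (hA : IsUnit A.det) (hB : IsUnit B.det) (hAB : IsUnit (A + B).det) :
    (A + B)⁻¹ + A⁻¹ * (A⁻¹ + B⁻¹)⁻¹ * A⁻¹ = A⁻¹ := by
  have hsum : A⁻¹ + B⁻¹ = A⁻¹ * (A + B) * B⁻¹ := by
    rw [mul_add, add_mul, nonsing_inv_mul A hA, one_mul, mul_assoc, mul_nonsing_inv B hB,
      mul_one, add_comm]
  have hS : (A⁻¹ + B⁻¹)⁻¹ = B * (A + B)⁻¹ * A := by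
    rw [hsum, Matrix.mul_inv_rev, Matrix.mul_inv_rev, nonsing_inv_nonsing_inv A hA,
      nonsing_inv_nonsing_inv B hB, mul_assoc]
  calc (A + B)⁻¹ + A⁻¹ * (A⁻¹ + B⁻¹)⁻¹ * A⁻¹
      = (A⁻¹ * A) * (A + B)⁻¹ + A⁻¹ * B * (A + B)⁻¹ * (A * A⁻¹) := by
        rw [hS, nonsing_inv_mul A hA]
        simp only [one_mul, mul_assoc]
    _ = A⁻¹ * ((A + B) * (A + B)⁻¹) := by
        rw [mul_nonsing_inv A hA, mul_one, ← add_mul, ← mul_add, mul_assoc]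
    _ = A⁻¹ := by rw [mul_nonsing_inv _ hAB, mul_one]

/-- The parallelogram identity for the quadratic form of a matrix. -/
theorem half_dotProduct_mulVec_add {n : Type*} [Fintype n] (M : Matrix n n ℝ) (x y : n → ℝ) :
    1 / 2 * (x ⬝ᵥ (M *ᵥ x)) + 1 / 2 * (y ⬝ᵥ (M *ᵥ y)) =
      1 / 4 * ((y + x) ⬝ᵥ (M *ᵥ (y + x))) + 1 / 4 * ((y - x) ⬝ᵥ (M *ᵥ (y - x))) := by
  simp only [mulVec_add, mulVec_sub, dotProduct_add, dotProduct_sub, add_dotProduct,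
    sub_dotProduct]
  ring

/-- Completion of the square relating the quadratic form of the prior Gaussian state
with covariance `α` and the Gaussian position-measurement noise quadratic forms to
the quadratic form of the posterior covariance matrix `α̂`. -/
theorem theta_posterior (s : ℕ) (hs : 0 < s)
    (Aqq Aqp App β : Matrix (Fin s) (Fin s) ℝ)
    (hAqq : Aqq.PosDef) (hApp : App.IsSymm) (hβ : β.PosDef)
    (hatqq hatqp hatpp : Matrix (Fin s) (Fin s) ℝ)
    (h1 : hatqq = (Aqq⁻¹ + β⁻¹)⁻¹)
    (h2 : hatqp = (Aqq⁻¹ + β⁻¹)⁻¹ * Aqq⁻¹ * Aqp)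
    (h3 : hatpp = App - Aqpᵀ * (Aqq + β)⁻¹ * Aqp + (1/4 : ℝ) • β⁻¹) :
    ∀ ξ ξ' : Fin s → ℝ,
      ((1/2 * (ξ ⬝ᵥ (β⁻¹ *ᵥ ξ)) : ℝ) : ℂ) + ((1/2 * (ξ' ⬝ᵥ (β⁻¹ *ᵥ ξ')) : ℝ) : ℂ)
          + theta Aqq Aqp App ξ ξ'
        = theta hatqq hatqp hatpp ξ ξ' := by
  intro ξ ξ'
  have hA : IsUnit Aqq.det := hAqq.det_pos.ne'.isUnit
  have hB : IsUnit β.det := hβ.det_pos.ne'.isUnit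
  have hAB : IsUnit (Aqq + β).det := (hAqq.add hβ).det_pos.ne'.isUnit
  have hS : IsUnit (Aqq⁻¹ + β⁻¹).det := (hAqq.inv.add hβ.inv).det_pos.ne'.isUnit
  have hAt : (Aqq⁻¹)ᵀ = Aqq⁻¹ := by simpa using hAqq.inv.isHermitian.eq
  have hSt : ((Aqq⁻¹ + β⁻¹)⁻¹)ᵀ = (Aqq⁻¹ + β⁻¹)⁻¹ := by
    simpa using (hAqq.inv.add hβ.inv).inv.isHermitian.eq
  have hqq : hatqq⁻¹ = Aqq⁻¹ + β⁻¹ := by rw [h1, nonsing_inv_nonsing_inv _ hS]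
  have hqp : hatqq⁻¹ * hatqp = Aqq⁻¹ * Aqp := by
    rw [hqq, h2, mul_assoc, mul_nonsing_inv_cancel_left _ _ hS]
  have hpp : hatpp - hatqpᵀ * hatqq⁻¹ * hatqp =
      App - Aqpᵀ * Aqq⁻¹ * Aqp + (1 / 4 : ℝ) • β⁻¹ := by
    have hschur : hatqpᵀ * hatqq⁻¹ * hatqp =
        Aqpᵀ * (Aqq⁻¹ * (Aqq⁻¹ + β⁻¹)⁻¹ * Aqq⁻¹) * Aqp := by
      rw [mul_assoc, hqp, h2, transpose_mul, transpose_mul, hAt, hSt]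
      simp only [mul_assoc]
    have hwood : Aqpᵀ * Aqq⁻¹ * Aqp = Aqpᵀ * (Aqq + β)⁻¹ * Aqp +
        Aqpᵀ * (Aqq⁻¹ * (Aqq⁻¹ + β⁻¹)⁻¹ * Aqq⁻¹) * Aqp := by
      rw [← add_mul, ← mul_add, inv_add_add_inv_mul_mul_inv hA hB hAB]
    rw [hschur, hwood, h3]
    abel
  unfold theta
  rw [hqp, hpp, hqq, ← Complex.ofReal_add, half_dotProduct_mulVec_add]
  simp only [add_mulVec, smul_mulVec, dotProduct_add, dotProduct_smul, smul_eq_mul]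
  push_cast
  ring
end

section
/- Let α = [[α_qq, α_qp],[α_pq, α_pp]] be a real symmetric 2s×2s matrix with α_qq positive definite and let β be a real symmetric positive definite s×s matrix. Define 𝛼̂_qq = (α_qq⁻¹+β⁻¹)⁻¹, 𝛼̂_qp = 𝛼̂_pqᵀ = (α_qq⁻¹+β⁻¹)⁻¹ α_qq⁻¹ α_qp, 𝛼̂_pp = α_pp − α_pq(α_qq+β)⁻¹α_qp + (1/4)β⁻¹, K_q = α_qq(α_qq+β)⁻¹, K_p = α_pq(α_qq+β)⁻¹, and p(x) = ((2π)^s det(α_qq+β))^{-1/2} exp(-(1/2) xᵀ(α_qq+β)⁻¹x). Then for all x, ξ, ξ' ∈ ℝ^s: ((2π)^s det β)^{-1/2} exp(-(1/4)(ξ−x)ᵀβ⁻¹(ξ−x)) · K_α(ξ,ξ') · exp(-(1/4)(ξ'−x)ᵀβ⁻¹(ξ'−x)) = p(x) · ((2π)^s det 𝛼̂_qq)^{-1/2} exp( μ(x; ξ, ξ') − (1/2) θ_𝛼̂(ξ,ξ') ), where μ(x; ξ, ξ') = (1/2)(K_q x)ᵀ 𝛼̂_qq⁻¹ (ξ'+ξ)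 − i(K_p x − 𝛼̂_pq 𝛼̂_qq⁻¹ K_q x)ᵀ(ξ'−ξ) − (1/2)(K_q x)ᵀ 𝛼̂_qq⁻¹ (K_q x). (This says that the posterior states of the Gaussian approximate position measurement in the Gaussian state with covariance α are displaced Gaussian states with covariance 𝛼̂ and means K_q x, K_p x.) -/
open Matrix

/-- The Schrödinger-representation kernel of the centered Gaussian state with
covariance blocks `Aqq, Aqp, Aqpᵀ, App`:
`K_α(ξ,ξ') = ((2π)^s det α_qq)^{-1/2} exp(-(1/2) θ_α(ξ,ξ'))`. -/
noncomputable def gaussKernel {s : ℕ} (Aqq Aqp App : Matrix (Fin s) (Fin s) ℝ)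
    (ξ ξ' : Fin s → ℝ) : ℂ :=
  (((Real.sqrt ((2 * Real.pi) ^ s * Aqq.det))⁻¹ : ℝ) : ℂ)
    * Complex.exp (-(1/2 : ℂ) * theta Aqq Aqp App ξ ξ')

namespace Matrix

variable {n : Type*} [Fintype n]

theorem IsSymm.dotProduct_mulVec_comm {M : Matrix n n ℝ} (hM : M.IsSymm) (u v : n → ℝ) :
    u ⬝ᵥ (M *ᵥ v) = v ⬝ᵥ (M *ᵥ u) := by
  rw [dotProduct_mulVec, ← mulVec_transpose, hM.eq, dotProduct_comm]

variable [DecidableEq n]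

theorem inv_inv_add_inv {A B : Matrix n n ℝ} (hA : IsUnit A.det) (hB : IsUnit B.det) :
    (A⁻¹ + B⁻¹)⁻¹ = B * (A + B)⁻¹ * A := by
  rw [inv_add_inv (by simp only [isUnit_iff_isUnit_det, hA, hB]), mul_inv_rev, mul_inv_rev,
    nonsing_inv_nonsing_inv _ hA, nonsing_inv_nonsing_inv _ hB, Matrix.mul_assoc]

theorem inv_add_inv_mul_mul_inv_add {A B : Matrix n n ℝ} (hA : IsUnit A.det)
    (hB : IsUnit B.det) (hS : IsUnit (A + B).det) :
    (A⁻¹ + B⁻¹) * (A * (A + B)⁻¹) = B⁻¹ := by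
  have h : (A⁻¹ + B⁻¹) * A = B⁻¹ * (A + B) := by
    rw [Matrix.add_mul, Matrix.mul_add, nonsing_inv_mul _ hA, nonsing_inv_mul _ hB, add_comm]
  rw [← Matrix.mul_assoc, h, Matrix.mul_assoc, mul_nonsing_inv _ hS, Matrix.mul_one]

theorem inv_add_mul_mul_inv {A B : Matrix n n ℝ} (hB : IsUnit B.det)
    (hS : IsUnit (A + B).det) :
    (A + B)⁻¹ * A * B⁻¹ = B⁻¹ - (A + B)⁻¹ := by
  have h : A * B⁻¹ = (A + B) * B⁻¹ - 1 := by
    rw [Matrix.add_mul, mul_nonsing_inv _ hB, add_sub_cancel_right]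
  rw [Matrix.mul_assoc, h, Matrix.mul_sub, ← Matrix.mul_assoc, nonsing_inv_mul _ hS,
    Matrix.one_mul, Matrix.mul_one]

theorem inv_add_add_inv_mul_inv_inv_add_inv_mul_inv {A B : Matrix n n ℝ} (hA : IsUnit A.det)
    (hB : IsUnit B.det) (hS : IsUnit (A + B).det) :
    (A + B)⁻¹ + A⁻¹ * ((A⁻¹ + B⁻¹)⁻¹ * A⁻¹) = A⁻¹ := by
  rw [inv_inv_add_inv hA hB, mul_nonsing_inv_cancel_right _ _ hA, ← Matrix.mul_assoc]
  have h : 1 + A⁻¹ * B = A⁻¹ * (A + B) := by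
    rw [Matrix.mul_add, nonsing_inv_mul _ hA]
  calc (A + B)⁻¹ + A⁻¹ * B * (A + B)⁻¹ = (1 + A⁻¹ * B) * (A + B)⁻¹ := by
        rw [Matrix.add_mul, Matrix.one_mul]
    _ = A⁻¹ := by rw [h, Matrix.mul_assoc, mul_nonsing_inv _ hS, Matrix.mul_one]

end Matrix

/-- The posterior states of the s-mode Gaussian approximate position measurement with
noise covariance `β` in the centered Gaussian state with covariance `α` are displaced
Gaussian states with covariance `α̂` and means `K_q x`, `K_p x`: identity of kernels
of `V(x) ρ_α V(x)` and `p(x) · D(K_q x, K_p x) ρ_α̂ D(K_q x, K_p x)*`. -/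
theorem posterior_kernel (s : ℕ) (hs : 0 < s)
    (Aqq Aqp App β : Matrix (Fin s) (Fin s) ℝ)
    (hAqq : Aqq.PosDef) (hApp : App.IsSymm) (hβ : β.PosDef)
    (hatqq hatqp hatpp Kq Kp : Matrix (Fin s) (Fin s) ℝ)
    (h1 : hatqq = (Aqq⁻¹ + β⁻¹)⁻¹)
    (h2 : hatqp = (Aqq⁻¹ + β⁻¹)⁻¹ * Aqq⁻¹ * Aqp)
    (h3 : hatpp = App - Aqpᵀ * (Aqq + β)⁻¹ * Aqp + (1/4 : ℝ) • β⁻¹)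
    (hKq : Kq = Aqq * (Aqq + β)⁻¹)
    (hKp : Kp = Aqpᵀ * (Aqq + β)⁻¹)
    (p : (Fin s → ℝ) → ℝ)
    (hp : ∀ x, p x = (Real.sqrt ((2 * Real.pi) ^ s * (Aqq + β).det))⁻¹
        * Real.exp (-(1/2) * (x ⬝ᵥ ((Aqq + β)⁻¹ *ᵥ x)))) :
    ∀ x ξ ξ' : Fin s → ℝ,
      (((Real.sqrt ((2 * Real.pi) ^ s * β.det))⁻¹
            * Real.exp (-(1/4) * ((ξ - x) ⬝ᵥ (β⁻¹ *ᵥ (ξ - x))))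
            * Real.exp (-(1/4) * ((ξ' - x) ⬝ᵥ (β⁻¹ *ᵥ (ξ' - x)))) : ℝ) : ℂ)
          * gaussKernel Aqq Aqp App ξ ξ'
        = ((p x : ℝ) : ℂ) * (((Real.sqrt ((2 * Real.pi) ^ s * hatqq.det))⁻¹ : ℝ) : ℂ)
            * Complex.exp (
                (((1/2) * ((Kq *ᵥ x) ⬝ᵥ (hatqq⁻¹ *ᵥ (ξ' + ξ))) : ℝ) : ℂ)
                - Complex.I
                    * ((((Kp *ᵥ x - (hatqpᵀ * hatqq⁻¹) *ᵥ (Kq *ᵥ x)) ⬝ᵥ (ξ' - ξ)) : ℝ) : ℂ)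
                - (((1/2) * ((Kq *ᵥ x) ⬝ᵥ (hatqq⁻¹ *ᵥ (Kq *ᵥ x))) : ℝ) : ℂ)
                - (1/2 : ℂ) * theta hatqq hatqp hatpp ξ ξ') := by
  have hS : (Aqq + β).PosDef := hAqq.add hβ
  have uA : IsUnit Aqq.det := hAqq.det_pos.ne'.isUnit
  have uB : IsUnit β.det := hβ.det_pos.ne'.isUnit
  have uS : IsUnit (Aqq + β).det := hS.det_pos.ne'.isUnit
  have sA : Aqqᵀ = Aqq := hAqq.isHermitian
  have sB : βᵀ = β := hβ.isHermitian
  have sA' : (Aqq⁻¹)ᵀ = Aqq⁻¹ := by rw [transpose_nonsing_inv, sA]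
  have sB' : (β⁻¹)ᵀ = β⁻¹ := by rw [transpose_nonsing_inv, sB]
  have sS' : ((Aqq + β)⁻¹)ᵀ = (Aqq + β)⁻¹ := by
    rw [transpose_nonsing_inv, transpose_add, sA, sB]
  have hH : (Aqq⁻¹ + β⁻¹).PosDef := hAqq.inv.add hβ.inv
  have uH : IsUnit (Aqq⁻¹ + β⁻¹).det := hH.det_pos.ne'.isUnit
  have sH : (Aqq⁻¹ + β⁻¹)ᵀ = Aqq⁻¹ + β⁻¹ := by rw [transpose_add, sA', sB']
  have inv_hatqq : hatqq⁻¹ = Aqq⁻¹ + β⁻¹ := by rw [h1, nonsing_inv_nonsing_inv _ uH]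
  have inv_hatqq_mul_Kq : hatqq⁻¹ * Kq = β⁻¹ := by
    rw [inv_hatqq, hKq, inv_add_inv_mul_mul_inv_add uA uB uS]
  have inv_hatqq_mul_hatqp : hatqq⁻¹ * hatqp = Aqq⁻¹ * Aqp := by
    rw [inv_hatqq, h2, Matrix.mul_assoc, mul_nonsing_inv_cancel_left _ _ uH]
  have hatqp_mul_inv_hatqq : hatqpᵀ * hatqq⁻¹ = Aqpᵀ * Aqq⁻¹ := by
    have h := congrArg transpose inv_hatqq_mul_hatqp
    rwa [transpose_mul, transpose_mul, sA', inv_hatqq, sH, ← inv_hatqq] at h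
  have schur : hatpp - hatqpᵀ * hatqq⁻¹ * hatqp
      = (App - Aqpᵀ * Aqq⁻¹ * Aqp) + (1/4 : ℝ) • β⁻¹ := by
    have h : Aqpᵀ * Aqq⁻¹ * Aqp
        = Aqpᵀ * (Aqq + β)⁻¹ * Aqp + Aqpᵀ * Aqq⁻¹ * hatqp := by
      conv_lhs => rw [← inv_add_add_inv_mul_inv_inv_add_inv_mul_inv uA uB uS]
      rw [h2]
      simp only [Matrix.mul_add, Matrix.add_mul, Matrix.mul_assoc]
    rw [hatqp_mul_inv_hatqq, h, h3]
    abel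
  have hdet : β.det * Aqq.det = (Aqq + β).det * hatqq.det := by
    rw [h1, inv_inv_add_inv uA uB, det_mul, det_mul, det_nonsing_inv, Ring.inverse_eq_inv']
    field_simp [hS.det_pos.ne']
  intro x ξ ξ'
  have momentum_shift : Kp *ᵥ x - (hatqpᵀ * hatqq⁻¹) *ᵥ (Kq *ᵥ x) = 0 := by
    rw [hatqp_mul_inv_hatqq, mulVec_mulVec, hKq, hKp, Matrix.mul_assoc,
      nonsing_inv_mul_cancel_left _ _ uA, sub_self]
  have linear_term : (Kq *ᵥ x) ⬝ᵥ (hatqq⁻¹ *ᵥ (ξ' + ξ)) = x ⬝ᵥ (β⁻¹ *ᵥ (ξ' + ξ)) := by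
    have symm : (hatqq⁻¹).IsSymm := by rw [inv_hatqq]; exact sH
    rw [symm.dotProduct_mulVec_comm, mulVec_mulVec, inv_hatqq_mul_Kq,
      IsSymm.dotProduct_mulVec_comm sB']
  have constant_term : (Kq *ᵥ x) ⬝ᵥ (hatqq⁻¹ *ᵥ (Kq *ᵥ x))
      = x ⬝ᵥ (β⁻¹ *ᵥ x) - x ⬝ᵥ ((Aqq + β)⁻¹ *ᵥ x) := by
    rw [mulVec_mulVec, inv_hatqq_mul_Kq, dotProduct_comm, dotProduct_mulVec, ← mulVec_transpose,
      mulVec_mulVec, hKq, transpose_mul, sS', sA, inv_add_mul_mul_inv uB uS, sub_mulVec,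
      sub_dotProduct, dotProduct_comm, dotProduct_comm ((Aqq + β)⁻¹ *ᵥ x)]
  have hsqrt : (Real.sqrt ((2 * Real.pi) ^ s * β.det))⁻¹
        * (Real.sqrt ((2 * Real.pi) ^ s * Aqq.det))⁻¹
      = (Real.sqrt ((2 * Real.pi) ^ s * (Aqq + β).det))⁻¹
        * (Real.sqrt ((2 * Real.pi) ^ s * hatqq.det))⁻¹ := by
    have hpi : (0 : ℝ) < (2 * Real.pi) ^ s := by positivity
    rw [← mul_inv, ← mul_inv, ← Real.sqrt_mul (mul_pos hpi hβ.det_pos).le,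
      ← Real.sqrt_mul (mul_pos hpi hS.det_pos).le, mul_mul_mul_comm, hdet, mul_mul_mul_comm]
  have hquad : -(1/4) * ((ξ - x) ⬝ᵥ (β⁻¹ *ᵥ (ξ - x))) + -(1/4) * ((ξ' - x) ⬝ᵥ (β⁻¹ *ᵥ (ξ' - x)))
      = -(1/8) * ((ξ' + ξ) ⬝ᵥ (β⁻¹ *ᵥ (ξ' + ξ))) - 1/8 * ((ξ' - ξ) ⬝ᵥ (β⁻¹ *ᵥ (ξ' - ξ)))
        + 1/2 * (x ⬝ᵥ (β⁻¹ *ᵥ (ξ' + ξ))) - 1/2 * (x ⬝ᵥ (β⁻¹ *ᵥ x)) := by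
    have e := IsSymm.dotProduct_mulVec_comm sB' ξ x
    have e' := IsSymm.dotProduct_mulVec_comm sB' ξ' x
    simp only [mulVec_add, mulVec_sub, dotProduct_add, dotProduct_sub, add_dotProduct,
      sub_dotProduct]
    linarith
  have hexp : ((-(1/4) * ((ξ - x) ⬝ᵥ (β⁻¹ *ᵥ (ξ - x))) : ℝ) : ℂ)
        + ((-(1/4) * ((ξ' - x) ⬝ᵥ (β⁻¹ *ᵥ (ξ' - x))) : ℝ) : ℂ)
        + -(1/2 : ℂ) * theta Aqq Aqp App ξ ξ'
      = ((-(1/2) * (x ⬝ᵥ ((Aqq + β)⁻¹ *ᵥ x)) : ℝ) : ℂ)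
        + ((((1/2) * ((Kq *ᵥ x) ⬝ᵥ (hatqq⁻¹ *ᵥ (ξ' + ξ))) : ℝ) : ℂ)
          - Complex.I
              * ((((Kp *ᵥ x - (hatqpᵀ * hatqq⁻¹) *ᵥ (Kq *ᵥ x)) ⬝ᵥ (ξ' - ξ)) : ℝ) : ℂ)
          - (((1/2) * ((Kq *ᵥ x) ⬝ᵥ (hatqq⁻¹ *ᵥ (Kq *ᵥ x))) : ℝ) : ℂ)
          - (1/2 : ℂ) * theta hatqq hatqp hatpp ξ ξ') := by
    rw [momentum_shift, linear_term, constant_term, ← Complex.ofReal_add, hquad, theta, theta,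
      schur, inv_hatqq_mul_hatqp, inv_hatqq, zero_dotProduct]
    simp only [add_mulVec, smul_mulVec, dotProduct_add, dotProduct_smul, smul_eq_mul]
    push_cast
    ring
  rw [hp, gaussKernel]
  simp only [Complex.ofReal_mul, Complex.ofReal_exp] at hexp ⊢
  have hsqrtC := congrArg (fun r : ℝ => (r : ℂ)) hsqrt
  simp only [Complex.ofReal_mul] at hsqrtC
  have hexpC := congrArg Complex.exp hexp
  rw [Complex.exp_add, Complex.exp_add, Complex.exp_add] at hexpC
  linear_combination congrArg₂ (· * ·) hsqrtC hexpC
end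

section
/- Let α = [[α_qq, α_qp],[α_pq, α_pp]] be a real symmetric 2s×2s matrix with α_qq positive definite, let Ω = [[0, I_s],[−I_s, 0]], and suppose the complex Hermitian matrix α + (i/2)Ω is positive semidefinite. Let β be a real symmetric positive definite s×s matrix and define 𝛼̂_qq = (α_qq⁻¹+β⁻¹)⁻¹, 𝛼̂_qp = 𝛼̂_pqᵀ = (α_qq⁻¹+β⁻¹)⁻¹ α_qq⁻¹ α_qp, 𝛼̂_pp = α_pp − α_pq(α_qq+β)⁻¹α_qp + (1/4)β⁻¹, and 𝛼̂ = [[𝛼̂_qq, 𝛼̂_qp],[𝛼̂_pq, 𝛼̂_pp]]. Then 𝛼̂ + (i/2)Ω is positive semidefinite. -/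
open Matrix ComplexOrder

open scoped MatrixOrder

namespace Matrix

section Woodbury

variable {n α : Type*} [Fintype n] [DecidableEq n] [CommRing α]

/-- The parallel sum `(A⁻¹ + B⁻¹)⁻¹` sandwiched between two copies of `A⁻¹`. -/
theorem inv_mul_parallelSum_mul_inv {A B : Matrix n n α} (hA : IsUnit A) (hB : IsUnit B)
    (hAB : IsUnit (A + B)) :
    A⁻¹ * (A⁻¹ + B⁻¹)⁻¹ * A⁻¹ = A⁻¹ - (A + B)⁻¹ := by
  rw [isUnit_iff_isUnit_det] at hA hB hAB
  have hsum : (A⁻¹ + B⁻¹)⁻¹ = B * (A + B)⁻¹ * A := by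
    refine inv_eq_left_inv ?_
    have h : A * (A⁻¹ + B⁻¹) = (A + B) * B⁻¹ := by
      rw [mul_add, add_mul, mul_nonsing_inv _ hA, mul_nonsing_inv _ hB, add_comm]
    rw [Matrix.mul_assoc, h, Matrix.mul_assoc, nonsing_inv_mul_cancel_left _ _ hAB,
      mul_nonsing_inv _ hB]
  rw [hsum, Matrix.mul_assoc, Matrix.mul_assoc, mul_nonsing_inv _ hA, Matrix.mul_one,
    eq_sub_iff_add_eq]
  calc A⁻¹ * (B * (A + B)⁻¹) + (A + B)⁻¹
      = A⁻¹ * ((A + B) * (A + B)⁻¹) := by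
        rw [add_mul, mul_add, nonsing_inv_mul_cancel_left _ _ hA, add_comm]
    _ = A⁻¹ := by rw [mul_nonsing_inv _ hAB, Matrix.mul_one]

end Woodbury

theorem map_nonsing_inv {n α β : Type*} [Fintype n] [DecidableEq n] [CommRing α] [CommRing β]
    (f : α →+* β) {A : Matrix n n α} (hA : IsUnit A) : A⁻¹.map f = (A.map f)⁻¹ := by
  refine (inv_eq_left_inv ?_).symm
  rw [← Matrix.map_mul, nonsing_inv_mul _ ((isUnit_iff_isUnit_det A).mp hA),
    Matrix.map_one _ (map_zero f) (map_one f)]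

theorem PosDef.map_ofReal {n 𝕜 : Type*} [Fintype n] [DecidableEq n] [RCLike 𝕜]
    {A : Matrix n n ℝ} (hA : A.PosDef) : (A.map (algebraMap ℝ 𝕜)).PosDef := by
  refine (PosSemidef.posDef_iff_isUnit ?_).mpr (hA.isUnit.map (algebraMap ℝ 𝕜).mapMatrix)
  obtain ⟨B, rfl⟩ := CStarAlgebra.nonneg_iff_eq_star_mul_self.mp hA.posSemidef.nonneg
  rw [star_eq_conjTranspose, Matrix.map_mul,
    conjTranspose_map _ (fun x => by simp)]
  exact posSemidef_conjTranspose_mul_self _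

/-- Conditioning on a noisy observation of the first block, with a shift `C` of the off-diagonal
block compensated by `Cᴴ * B⁻¹ * C`, leaves the Schur complement unchanged. -/
theorem PosSemidef.fromBlocks_conditioned_iff {m n 𝕜 : Type*} [Fintype m] [Finite n]
    [DecidableEq m] [RCLike 𝕜] {A B : Matrix m m 𝕜} (hA : A.PosDef) (hB : B.PosDef)
    (X C : Matrix m n 𝕜) (P : Matrix n n 𝕜) :
    (fromBlocks (A⁻¹ + B⁻¹)⁻¹ ((A⁻¹ + B⁻¹)⁻¹ * A⁻¹ * X + C)
        ((A⁻¹ + B⁻¹)⁻¹ * A⁻¹ * X + C)ᴴ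
        (P - Xᴴ * (A + B)⁻¹ * X + Cᴴ * B⁻¹ * C)).PosSemidef ↔
      (fromBlocks A (X + C) (X + C)ᴴ P).PosSemidef := by
  have hK : (A⁻¹ + B⁻¹).PosDef := hA.inv.add hB.inv
  have hKdet := (isUnit_iff_isUnit_det _).mp hK.isUnit
  let := hA.isUnit.invertible
  let := hK.inv.isUnit.invertible
  rw [PosDef.fromBlocks₁₁ _ _ hA, PosDef.fromBlocks₁₁ _ _ hK.inv,
    nonsing_inv_nonsing_inv _ hKdet]
  have hWoodbury := inv_mul_parallelSum_mul_inv hA.isUnit hB.isUnit (hA.add hB).isUnit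
  have hA' : (A⁻¹)ᴴ = A⁻¹ := hA.inv.isHermitian
  have hK' : ((A⁻¹ + B⁻¹)⁻¹)ᴴ = (A⁻¹ + B⁻¹)⁻¹ := hK.inv.isHermitian
  have hsquare : ((A⁻¹ + B⁻¹)⁻¹ * A⁻¹ * X + C)ᴴ * (A⁻¹ + B⁻¹) *
        ((A⁻¹ + B⁻¹)⁻¹ * A⁻¹ * X + C) =
      Xᴴ * (A⁻¹ * (A⁻¹ + B⁻¹)⁻¹ * A⁻¹) * X + Xᴴ * A⁻¹ * C + Cᴴ * A⁻¹ * X +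
        Cᴴ * (A⁻¹ + B⁻¹) * C := by
    generalize A⁻¹ + B⁻¹ = K at *
    simp only [conjTranspose_add, conjTranspose_mul, hA', hK', Matrix.add_mul, Matrix.mul_add,
      Matrix.mul_assoc, mul_nonsing_inv_cancel_left _ _ hKdet,
      nonsing_inv_mul_cancel_left _ _ hKdet]
    abel
  rw [hsquare, hWoodbury]
  refine iff_of_eq (congrArg _ ?_)
  simp only [conjTranspose_add, Matrix.add_mul, Matrix.mul_add, Matrix.sub_mul, Matrix.mul_sub]
  abel

end Matrix

/-- If `α = [[α_qq, α_qp],[α_pq, α_pp]]` is an admissible quantum covariance matrix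
(i.e. `α + (i/2)Ω ≥ 0` with `Ω = [[0, I],[−I, 0]]`), then the posterior covariance
matrix `α̂` of the Gaussian approximate position measurement with noise covariance
`β` is again admissible: `α̂ + (i/2)Ω ≥ 0`. -/
theorem posterior_covariance_admissible (s : ℕ) (hs : 0 < s)
    (Aqq Aqp App β : Matrix (Fin s) (Fin s) ℝ)
    (hAqq : Aqq.PosDef) (hApp : App.IsSymm) (hβ : β.PosDef)
    (Ω : Matrix (Fin s ⊕ Fin s) (Fin s ⊕ Fin s) ℂ)
    (hΩ : Ω = Matrix.fromBlocks 0 1 (-1) 0)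
    (hatqq hatqp hatpp : Matrix (Fin s) (Fin s) ℝ)
    (h1 : hatqq = (Aqq⁻¹ + β⁻¹)⁻¹)
    (h2 : hatqp = (Aqq⁻¹ + β⁻¹)⁻¹ * Aqq⁻¹ * Aqp)
    (h3 : hatpp = App - Aqpᵀ * (Aqq + β)⁻¹ * Aqp + (1/4 : ℝ) • β⁻¹)
    (hadm : ((Matrix.fromBlocks Aqq Aqp Aqpᵀ App).map Complex.ofReal
        + (Complex.I / 2) • Ω).PosSemidef) :
    ((Matrix.fromBlocks hatqq hatqp hatqpᵀ hatpp).map Complex.ofReal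
        + (Complex.I / 2) • Ω).PosSemidef := by
  set K := (Aqq⁻¹ + β⁻¹)⁻¹ with hK
  let f : ℝ →+* ℂ := algebraMap ℝ ℂ
  have hsum : (Aqq⁻¹ + β⁻¹).PosDef := hAqq.inv.add hβ.inv
  have hKmap : K.map f = ((Aqq.map f)⁻¹ + (β.map f)⁻¹)⁻¹ := by
    rw [hK, map_nonsing_inv f hsum.isUnit, Matrix.map_add _ (map_add f),
      map_nonsing_inv f hAqq.isUnit, map_nonsing_inv f hβ.isUnit]
  have hconj (Y : Matrix (Fin s) (Fin s) ℝ) : Yᵀ.map f = (Y.map f)ᴴ := by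
    ext i j
    simp [f]
  have hblocks (A X P : Matrix (Fin s) (Fin s) ℝ) :
      (fromBlocks A X Xᵀ P).map Complex.ofReal + (Complex.I / 2) • Ω =
        fromBlocks (A.map f) (X.map f + (Complex.I / 2) • 1)
          (X.map f + (Complex.I / 2) • 1)ᴴ (P.map f) := by
    have hI : star (Complex.I / 2) = -(Complex.I / 2) := by simp [neg_div]
    change (fromBlocks A X Xᵀ P).map f + _ = _
    rw [hΩ, fromBlocks_map, fromBlocks_smul, fromBlocks_add, hconj, conjTranspose_add,
      conjTranspose_smul, conjTranspose_one, hI]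
    simp
  have hqp : hatqp.map f = ((Aqq.map f)⁻¹ + (β.map f)⁻¹)⁻¹ * (Aqq.map f)⁻¹ * Aqp.map f := by
    rw [h2, Matrix.map_mul, Matrix.map_mul, hKmap, map_nonsing_inv f hAqq.isUnit]
  have hpp : hatpp.map f = App.map f - (Aqp.map f)ᴴ * (Aqq.map f + β.map f)⁻¹ * Aqp.map f +
      ((Complex.I / 2) • (1 : Matrix (Fin s) (Fin s) ℂ))ᴴ * (β.map f)⁻¹ *
        ((Complex.I / 2) • 1) := by
    have hquarter : ((1 / 4 : ℝ) • β⁻¹).map f =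
        ((Complex.I / 2) • (1 : Matrix (Fin s) (Fin s) ℂ))ᴴ * (β.map f)⁻¹ *
          ((Complex.I / 2) • 1) := by
      have hnorm : Complex.I / 2 * star (Complex.I / 2) = f (1 / 4) := by
        apply Complex.ext <;> norm_num [f]
      rw [conjTranspose_smul, conjTranspose_one, smul_mul, Matrix.one_mul, Matrix.mul_smul,
        Matrix.mul_one, smul_smul, hnorm, ← map_nonsing_inv f hβ.isUnit]
      ext i j
      simp [f]
    rw [h3, Matrix.map_add _ (map_add f), Matrix.map_sub _ (map_sub f), Matrix.map_mul,
      Matrix.map_mul, map_nonsing_inv f (hAqq.add hβ).isUnit, Matrix.map_add _ (map_add f),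
      hconj, hquarter]
  rw [hblocks] at hadm ⊢
  rw [h1, hKmap, hqp, hpp]
  exact (PosSemidef.fromBlocks_conditioned_iff hAqq.map_ofReal hβ.map_ofReal _ _ _).mpr hadm
end

section
/- Let α = [[A, C],[Cᵀ, B]] be a real symmetric 2s×2s matrix with s×s blocks and let Ω = [[0, I_s],[−I_s, 0]]. If the complex Hermitian matrix α + (i/2)Ω is positive semidefinite, then both [[A, 0],[0, B]] + (i/2)Ω and [[A, 0],[0, B]] − (i/2)Ω are positive semidefinite. (Consequently the block-diagonal matrix [[A,0],[0,B]], which is the average of the covariance matrices of a state ρ and its image under the time-reversal q_j → q_j, p_j → −p_j, is again an admissible quantum covariance matrix.) -/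
open Matrix ComplexOrder

/-- Time reversal `q ↦ q`, `p ↦ -p` of a covariance matrix, which changes the sign of the
off-diagonal blocks, preserves admissibility. -/
theorem posSemidef_fromBlocks_neg_offDiag {n : Type*} [Fintype n] [DecidableEq n]
    {A B C : Matrix n n ℝ} (hA : A.IsSymm) (hB : B.IsSymm)
    (h : ((fromBlocks A C Cᵀ B).map Complex.ofReal
      + (Complex.I / 2) • fromBlocks 0 1 (-1) 0).PosSemidef) :
    ((fromBlocks A (-C) (-Cᵀ) B).map Complex.ofReal
      + (Complex.I / 2) • fromBlocks 0 1 (-1) 0).PosSemidef := by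
  have key : (fromBlocks A (-C) (-Cᵀ) B).map Complex.ofReal
      + (Complex.I / 2) • fromBlocks 0 1 (-1) 0 =
      fromBlocks 1 0 0 (-1) * ((fromBlocks A C Cᵀ B).map Complex.ofReal
        + (Complex.I / 2) • fromBlocks 0 1 (-1) 0)ᵀ *
        (fromBlocks 1 0 0 (-1) : Matrix (n ⊕ n) (n ⊕ n) ℂ)ᴴ := by
    simp only [fromBlocks_map, fromBlocks_smul, fromBlocks_add, fromBlocks_transpose,
      fromBlocks_conjTranspose, fromBlocks_multiply]
    congr 1 <;> ext i j <;> simp [hA.apply i j, hB.apply i j, one_apply, add_comm]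
  rw [key]
  exact h.transpose.mul_mul_conjTranspose_same _

/-- If `α = [[A, C],[Cᵀ, B]]` satisfies the quantum admissibility condition
`α + (i/2)Ω ≥ 0` with `Ω = [[0, I],[−I, 0]]`, then the block-diagonal matrix
`[[A,0],[0,B]]` (the covariance matrix of the time-reversal average) satisfies
both `[[A,0],[0,B]] + (i/2)Ω ≥ 0` and `[[A,0],[0,B]] − (i/2)Ω ≥ 0`. -/
theorem blockDiagonal_admissible (s : ℕ) (hs : 0 < s)
    (A B C : Matrix (Fin s) (Fin s) ℝ) (hA : A.IsSymm) (hB : B.IsSymm)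
    (Ω : Matrix (Fin s ⊕ Fin s) (Fin s ⊕ Fin s) ℂ)
    (hΩ : Ω = Matrix.fromBlocks 0 1 (-1) 0)
    (hadm : ((Matrix.fromBlocks A C Cᵀ B).map Complex.ofReal
        + (Complex.I / 2) • Ω).PosSemidef) :
    ((Matrix.fromBlocks A 0 0 B).map Complex.ofReal
        + (Complex.I / 2) • Ω).PosSemidef ∧
    ((Matrix.fromBlocks A 0 0 B).map Complex.ofReal
        - (Complex.I / 2) • Ω).PosSemidef := by
  subst hΩ
  have average : (fromBlocks A 0 0 B).map Complex.ofReal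
      + (Complex.I / 2) • fromBlocks 0 1 (-1) 0 =
      (1 / 2 : ℝ) • (((fromBlocks A C Cᵀ B).map Complex.ofReal
          + (Complex.I / 2) • fromBlocks 0 1 (-1) 0)
        + ((fromBlocks A (-C) (-Cᵀ) B).map Complex.ofReal
          + (Complex.I / 2) • fromBlocks 0 1 (-1) 0)) := by
    simp only [fromBlocks_map, fromBlocks_smul, fromBlocks_add]
    congr 1 <;> ext i j <;> simp <;> ring
  have transposed : (fromBlocks A 0 0 B).map Complex.ofReal
      - (Complex.I / 2) • fromBlocks 0 1 (-1) 0 =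
      ((fromBlocks A 0 0 B).map Complex.ofReal
        + (Complex.I / 2) • fromBlocks 0 1 (-1) 0)ᵀ := by
    simp only [sub_eq_add_neg, fromBlocks_neg, fromBlocks_map, fromBlocks_smul,
      fromBlocks_add, fromBlocks_transpose]
    congr 1 <;> ext i j <;> simp [hA.apply i j, hB.apply i j, one_apply, eq_comm]
  rw [transposed, posSemidef_transpose_iff, and_self, average]
  exact (hadm.add (posSemidef_fromBlocks_neg_offDiag hA hB hadm)).smul (by norm_num)
end

section
/- Let g(x) = (x+1)·log(x+1) − x·log x for x > 0, with g(0) = 0 (natural logarithm). Let α_qq > 0, β > 0, and α_pp, α_qp be real numbers with D = α_qq α_pp − α_qp² ≥ 1/4. Then g(√D − 1/2) − g(√((βD + α_qq/4)/(α_qq+β)) − 1/2) ≥ 0, i.e. the entropy reduction ER(M;α) of the one-mode Gaussian approximate position measurement on the Gaussian state with covariance matrix [[α_qq, α_qp],[α_qp, α_pp]] is nonnegative. -/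
/-- `g(x) = (x+1)·log(x+1) − x·log x` (natural logarithm); since `Real.log 0 = 0`
in Mathlib, this formula also gives `g(0) = 0`. -/
noncomputable def g (x : ℝ) : ℝ := (x + 1) * Real.log (x + 1) - x * Real.log x

/-- The entropy function `g` is nondecreasing on `[0, ∞)`. -/
theorem g_monotoneOn : MonotoneOn g (Set.Ici 0) := by
  have hcont : Continuous g :=
    (Real.continuous_mul_log.comp (continuous_id.add continuous_const)).sub
      Real.continuous_mul_log
  have hderiv : ∀ x : ℝ, 0 < x → HasDerivAt g (Real.log (x + 1) - Real.log x) x := by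
    intro x hx
    have h := ((Real.hasDerivAt_mul_log (by positivity : x + 1 ≠ 0)).comp_add_const x 1).sub
      (Real.hasDerivAt_mul_log hx.ne')
    exact h.congr_deriv (by ring)
  refine monotoneOn_of_deriv_nonneg (convex_Ici 0) hcont.continuousOn ?_ ?_
  · rw [interior_Ici]
    exact fun x hx => (hderiv x hx).differentiableAt.differentiableWithinAt
  · rw [interior_Ici]
    intro x hx
    rw [(hderiv x hx).deriv, sub_nonneg]
    exact Real.log_le_log hx (by linarith)

/-- Nonnegativity of the entropy reduction `ER(M;α)` of the one-mode Gaussian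
approximate position measurement with noise variance `β` on the Gaussian state with
covariance matrix `[[α_qq, α_qp],[α_qp, α_pp]]` of determinant `D ≥ 1/4`. -/
theorem entropy_reduction_nonneg (aqq app aqp β D : ℝ)
    (haqq : 0 < aqq) (hβ : 0 < β) (hD : D = aqq * app - aqp ^ 2)
    (hDge : 1/4 ≤ D) :
    0 ≤ g (Real.sqrt D - 1/2)
        - g (Real.sqrt ((β * D + aqq / 4) / (aqq + β)) - 1/2) := by
  have hlow : 1 / 4 ≤ (β * D + aqq / 4) / (aqq + β) := by
    rw [le_div_iff₀ (by positivity)]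
    nlinarith
  have hup : (β * D + aqq / 4) / (aqq + β) ≤ D := by
    rw [div_le_iff₀ (by positivity)]
    nlinarith
  have hhalf : 1 / 2 ≤ Real.sqrt ((β * D + aqq / 4) / (aqq + β)) :=
    Real.le_sqrt_of_sq_le (by linarith)
  have hsqrt := Real.sqrt_le_sqrt hup
  exact sub_nonneg.2 (g_monotoneOn (sub_nonneg.2 hhalf)
    (sub_nonneg.2 (hhalf.trans hsqrt)) (sub_le_sub_right hsqrt _))
end

section
/- Let α = [[α_qq, α_qp],[α_pq, α_pp]] be a real symmetric 2s×2s matrix with s×s blocks (α_pq = α_qpᵀ) and α_qq positive definite, and let m_q, m_p ∈ ℝ^s. Then for all ξ, ξ' ∈ ℝ^s, setting u = (ξ+ξ')/2 and v = ξ'−ξ: (2π)^{−s} ∫_{ℝ^s} exp( −i uᵀx + i(m_qᵀ x − m_pᵀ v) − (1/2)(xᵀ α_qq x − 2 xᵀ α_qp v + vᵀ α_pp v) ) dx = ((2π)^s det α_qq)^{-1/2} exp( μ(m; ξ, ξ') − (1/2) θ_α(ξ, ξ') ), where μ(m; ξ, ξ') = (1/2) m_qᵀ α_qq⁻¹ (ξ'+ξ)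 − i(m_p − α_pq α_qq⁻¹ m_q)ᵀ(ξ'−ξ) − (1/2) m_qᵀ α_qq⁻¹ m_q. (This is the Schrödinger-representation kernel of the Gaussian density operator with means m_q, m_p and covariance matrix α, obtained by inverse quantum Fourier transform of its Gaussian characteristic function.) -/
open Matrix MeasureTheory

/-- Linear change of variables for the Bochner integral on `ι → ℝ`. -/
theorem integral_comp_mulVec {ι : Type*} [Fintype ι] [DecidableEq ι] {M : Matrix ι ι ℝ}
    (hM : M.det ≠ 0) {f : (ι → ℝ) → ℂ} (hf : Continuous f) :
    ∫ x, f (M *ᵥ x) = ((|M.det|⁻¹ : ℝ) : ℂ) * ∫ x, f x := by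
  have hmap := Real.map_matrix_volume_pi_eq_smul_volume_pi hM
  have hcont : Continuous (toLin' M) := LinearMap.continuous_on_pi _
  have hint := integral_map_of_stronglyMeasurable (μ := volume) hcont.measurable
    hf.stronglyMeasurable
  simp only [toLin'_apply] at hint
  rw [← hint, hmap, integral_smul_measure, ENNReal.toReal_ofReal (abs_nonneg _), abs_inv,
    Complex.real_smul]

/-- A real positive definite matrix is `Bᵀ * B` for some square `B`. -/
theorem Matrix.PosDef.exists_eq_transpose_mul_self {ι : Type*} [Fintype ι] [DecidableEq ι]
    {A : Matrix ι ι ℝ} (hA : A.PosDef) : ∃ B : Matrix ι ι ℝ, A = Bᵀ * B := by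
  open scoped MatrixOrder Matrix.Norms.L2Operator in
  obtain ⟨B, hB⟩ := CStarAlgebra.nonneg_iff_eq_star_mul_self.mp hA.posSemidef.nonneg
  exact ⟨B, by simpa [star_eq_conjTranspose] using hB⟩

/-- The standard Gaussian integral with a complex linear term `r + i w`. -/
theorem integral_cexp_neg_half_dotProduct_self_add {ι : Type*} [Fintype ι] (w r : ι → ℝ) :
    ∫ y : ι → ℝ, Complex.exp (-(1 / 2 : ℂ) * ((y ⬝ᵥ y : ℝ) : ℂ)
        + Complex.I * ((w ⬝ᵥ y : ℝ) : ℂ) + ((r ⬝ᵥ y : ℝ) : ℂ))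
      = ((Real.sqrt ((2 * Real.pi) ^ Fintype.card ι) : ℝ) : ℂ)
        * Complex.exp ((1 / 2 : ℂ) * ((r ⬝ᵥ r - w ⬝ᵥ w : ℝ) : ℂ)
          + Complex.I * ((w ⬝ᵥ r : ℝ) : ℂ)) := by
  have hgauss := GaussianFourier.integral_cexp_neg_mul_sum_add (ι := ι) (b := (1 / 2 : ℂ))
    (by norm_num) (fun i => Complex.I * w i + r i)
  convert hgauss using 1
  · congr 1
    ext y
    congr 1
    simp only [dotProduct, Complex.ofReal_sum, Complex.ofReal_mul, Finset.mul_sum, add_mul,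
      Finset.sum_add_distrib, ← add_assoc]
    simp only [pow_two, mul_assoc]
  · congr 1
    · rw [Real.sqrt_eq_rpow, ← Real.rpow_natCast, ← Real.rpow_mul (by positivity),
        Complex.ofReal_cpow (by positivity)]
      congr 1
      · push_cast
        ring
      · push_cast
        ring
    · congr 1
      simp only [dotProduct, Complex.ofReal_sub, Complex.ofReal_sum, Complex.ofReal_mul,
        Finset.mul_sum, Finset.sum_div, ← Finset.sum_sub_distrib, ← Finset.sum_add_distrib]
      refine Finset.sum_congr rfl fun i _ => ?_
      linear_combination (-(w i : ℂ) ^ 2 / 2) * Complex.I_sq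

/-- The Gaussian integral for a positive definite matrix with a complex linear term `r + i w`. -/
theorem Matrix.PosDef.integral_cexp_quadratic {ι : Type*} [Fintype ι] [DecidableEq ι]
    {A : Matrix ι ι ℝ} (hA : A.PosDef) (w r : ι → ℝ) :
    ∫ x : ι → ℝ, Complex.exp (-(1 / 2 : ℂ) * ((x ⬝ᵥ (A *ᵥ x) : ℝ) : ℂ)
        + Complex.I * ((w ⬝ᵥ x : ℝ) : ℂ) + ((r ⬝ᵥ x : ℝ) : ℂ))
      = (((Real.sqrt A.det)⁻¹ * Real.sqrt ((2 * Real.pi) ^ Fintype.card ι) : ℝ) : ℂ)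
        * Complex.exp ((1 / 2 : ℂ) * ((r ⬝ᵥ (A⁻¹ *ᵥ r) - w ⬝ᵥ (A⁻¹ *ᵥ w) : ℝ) : ℂ)
          + Complex.I * ((w ⬝ᵥ (A⁻¹ *ᵥ r) : ℝ) : ℂ)) := by
  obtain ⟨B, rfl⟩ := hA.exists_eq_transpose_mul_self
  have hdet : B.det ≠ 0 := fun h => hA.det_pos.ne' (by simp [h])
  have hunit : IsUnit B.det := hdet.isUnit
  have hsqrt : Real.sqrt (Bᵀ * B).det = |B.det| := by
    rw [det_mul, det_transpose, Real.sqrt_mul_self_eq_abs]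
  have hquad (x : ι → ℝ) : x ⬝ᵥ ((Bᵀ * B) *ᵥ x) = (B *ᵥ x) ⬝ᵥ (B *ᵥ x) := by
    rw [← mulVec_mulVec, dotProduct_mulVec, vecMul_transpose]
  have hlin (c x : ι → ℝ) : c ⬝ᵥ x = (c ᵥ* B⁻¹) ⬝ᵥ (B *ᵥ x) := by
    rw [← dotProduct_mulVec, mulVec_mulVec, nonsing_inv_mul _ hunit, one_mulVec]
  have hinv (c d : ι → ℝ) : c ⬝ᵥ ((Bᵀ * B)⁻¹ *ᵥ d) = (c ᵥ* B⁻¹) ⬝ᵥ (d ᵥ* B⁻¹) := by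
    rw [mul_inv_rev, ← mulVec_mulVec, dotProduct_mulVec, ← transpose_nonsing_inv,
      mulVec_transpose]
  simp only [hinv, hquad, hlin w, hlin r, hsqrt]
  rw [integral_comp_mulVec hdet (f := fun y => Complex.exp (-(1 / 2 : ℂ) * ((y ⬝ᵥ y : ℝ) : ℂ)
        + Complex.I * (((w ᵥ* B⁻¹) ⬝ᵥ y : ℝ) : ℂ) + (((r ᵥ* B⁻¹) ⬝ᵥ y : ℝ) : ℂ))) (by fun_prop),
    integral_cexp_neg_half_dotProduct_self_add, ← mul_assoc, Complex.ofReal_mul]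

/-- The Schrödinger-representation kernel of the Gaussian density operator with means
`m_q, m_p` and covariance matrix `α = [[α_qq, α_qp],[α_qpᵀ, α_pp]]`, obtained by the
inverse quantum Fourier transform of its Gaussian characteristic function (after
integrating out the delta function): with `u = (ξ+ξ')/2` and `v = ξ'−ξ`,
`(2π)^{−s} ∫ exp(−i uᵀx + i(m_qᵀx − m_pᵀv) − (1/2)(xᵀα_qq x − 2xᵀα_qp v + vᵀα_pp v)) dx
  = ((2π)^s det α_qq)^{-1/2} exp(μ(m;ξ,ξ') − (1/2)θ_α(ξ,ξ'))`. -/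
theorem gaussian_state_kernel (s : ℕ) (hs : 0 < s)
    (Aqq Aqp App : Matrix (Fin s) (Fin s) ℝ)
    (hAqq : Aqq.PosDef) (hApp : App.IsSymm)
    (mq mp : Fin s → ℝ) :
    ∀ ξ ξ' : Fin s → ℝ,
      ((((2 * Real.pi) ^ s)⁻¹ : ℝ) : ℂ)
          * ∫ x : Fin s → ℝ,
              Complex.exp (
                -Complex.I * (((((1/2 : ℝ) • (ξ + ξ')) ⬝ᵥ x) : ℝ) : ℂ)
                + Complex.I * (((mq ⬝ᵥ x - mp ⬝ᵥ (ξ' - ξ)) : ℝ) : ℂ)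
                - (1/2 : ℂ) * ((((x ⬝ᵥ (Aqq *ᵥ x)) - 2 * (x ⬝ᵥ (Aqp *ᵥ (ξ' - ξ)))
                    + ((ξ' - ξ) ⬝ᵥ (App *ᵥ (ξ' - ξ)))) : ℝ) : ℂ))
        = (((Real.sqrt ((2 * Real.pi) ^ s * Aqq.det))⁻¹ : ℝ) : ℂ)
            * Complex.exp (
                (((1/2) * (mq ⬝ᵥ (Aqq⁻¹ *ᵥ (ξ' + ξ))) : ℝ) : ℂ)
                - Complex.I * ((((mp - (Aqpᵀ * Aqq⁻¹) *ᵥ mq) ⬝ᵥ (ξ' - ξ)) : ℝ) : ℂ)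
                - (((1/2) * (mq ⬝ᵥ (Aqq⁻¹ *ᵥ mq)) : ℝ) : ℂ)
                - (1/2 : ℂ) * theta Aqq Aqp App ξ ξ') := by
  intro ξ ξ'
  have hint := hAqq.integral_cexp_quadratic (mq - (1 / 2 : ℝ) • (ξ + ξ')) (Aqp *ᵥ (ξ' - ξ))
  have hsymm : (Aqq⁻¹)ᵀ = Aqq⁻¹ := by
    simpa [IsHermitian] using hAqq.inv.isHermitian
  have hconst : ((2 * Real.pi) ^ s)⁻¹ * ((Real.sqrt Aqq.det)⁻¹ * Real.sqrt ((2 * Real.pi) ^ s))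
      = (Real.sqrt ((2 * Real.pi) ^ s * Aqq.det))⁻¹ := by
    have hpos : 0 < (2 * Real.pi) ^ s := by positivity
    have hdet : 0 < Real.sqrt Aqq.det := Real.sqrt_pos.mpr hAqq.det_pos
    rw [Real.sqrt_mul hpos.le]
    have hne : Real.sqrt ((2 * Real.pi) ^ s) ≠ 0 := (Real.sqrt_pos.mpr hpos).ne'
    field_simp
    exact Real.sq_sqrt hpos.le
  have hswap (a b : Fin s → ℝ) : a ⬝ᵥ (Aqq⁻¹ *ᵥ b) = b ⬝ᵥ (Aqq⁻¹ *ᵥ a) := by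
    rw [dotProduct_mulVec, ← mulVec_transpose, hsymm, dotProduct_comm]
  have hcross : ((Aqpᵀ * Aqq⁻¹) *ᵥ mq) ⬝ᵥ (ξ' - ξ)
      = mq ⬝ᵥ (Aqq⁻¹ *ᵥ (Aqp *ᵥ (ξ' - ξ))) := by
    rw [← mulVec_mulVec, mulVec_transpose, ← dotProduct_mulVec, dotProduct_comm, hswap mq,
      dotProduct_comm]
  have hquad : (ξ' - ξ) ⬝ᵥ ((Aqpᵀ * Aqq⁻¹ * Aqp) *ᵥ (ξ' - ξ))
      = (Aqp *ᵥ (ξ' - ξ)) ⬝ᵥ (Aqq⁻¹ *ᵥ (Aqp *ᵥ (ξ' - ξ))) := by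
    rw [← mulVec_mulVec, ← mulVec_mulVec, dotProduct_mulVec, vecMul_transpose]
  have hsplit (x : Fin s → ℝ) :
      -Complex.I * (((((1/2 : ℝ) • (ξ + ξ')) ⬝ᵥ x) : ℝ) : ℂ)
          + Complex.I * (((mq ⬝ᵥ x - mp ⬝ᵥ (ξ' - ξ)) : ℝ) : ℂ)
          - (1/2 : ℂ) * ((((x ⬝ᵥ (Aqq *ᵥ x)) - 2 * (x ⬝ᵥ (Aqp *ᵥ (ξ' - ξ)))
              + ((ξ' - ξ) ⬝ᵥ (App *ᵥ (ξ' - ξ)))) : ℝ) : ℂ)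
        = (-Complex.I * ((mp ⬝ᵥ (ξ' - ξ) : ℝ) : ℂ)
            - (1/2 : ℂ) * (((ξ' - ξ) ⬝ᵥ (App *ᵥ (ξ' - ξ)) : ℝ) : ℂ))
          + (-(1 / 2 : ℂ) * ((x ⬝ᵥ (Aqq *ᵥ x) : ℝ) : ℂ)
            + Complex.I * (((mq - (1 / 2 : ℝ) • (ξ + ξ')) ⬝ᵥ x : ℝ) : ℂ)
            + (((Aqp *ᵥ (ξ' - ξ)) ⬝ᵥ x : ℝ) : ℂ)) := by
    rw [dotProduct_comm (Aqp *ᵥ (ξ' - ξ)) x, sub_dotProduct mq]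
    push_cast
    ring
  simp_rw [hsplit, Complex.exp_add (_ - _)]
  rw [integral_const_mul, hint, Fintype.card_fin, ← hconst, mul_left_comm (Complex.exp _),
    ← Complex.exp_add, ← mul_assoc, ← Complex.ofReal_mul]
  congr 2
  rw [theta, sub_mulVec, dotProduct_sub _ (App *ᵥ _), hquad, sub_dotProduct mp, hcross,
    ← mulVec_mulVec, add_comm ξ ξ']
  generalize ξ' + ξ = u
  generalize ξ' - ξ = v
  simp only [mulVec_sub, mulVec_smul, dotProduct_sub, sub_dotProduct, smul_dotProduct,
    dotProduct_smul, smul_eq_mul, hswap u mq]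
  push_cast
  ring
end
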